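/- arXiv:1005.0422 — 2 statements merged into one kernel-verified Lean document; each statement's English description precedes it below -/
import Mathlib

section
/- Let $A$ be a commutative artinian algebraic ring over an algebraically closed field $K$, with Jacobson radical $J$. Then $A/J \cong (K,+,\cdot)^n \oplus C$ as algebraic rings, where $n = \dim A/J$ and $C$ is a finite algebraic ring. In particular, $A/J$ always virtually comes from an algebra. -/
noncomputable section

open MvPolynomial

/-- The Zariski topology on affine `n`-space over `K`. -/
def affineZariski (K : Type) [Field K] (n : ℕ) : TopologicalSpace (Fin n → K) :=
  TopologicalSpace.generateFrom
    {U | ∃ p : MvPolynomial (Fin n) K, U = {x | MvPolynomial.eval x p ≠ 0}}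

/-- An algebraic ring over `K`: a Zariski-closed subset of some affine space `K^n`
equipped with regular (polynomial) addition, negation and multiplication maps making it
into a unital ring whose additive group is a commutative algebraic group. -/
structure AlgebraicRing (K : Type) [Field K] where
  n : ℕ
  carrier : Set (Fin n → K)
  carrier_closed : ∃ S : Set (MvPolynomial (Fin n) K),
    carrier = {x | ∀ p ∈ S, MvPolynomial.eval x p = 0}
  add : (Fin n → K) → (Fin n → K) → Fin n → K
  mul : (Fin n → K) → (Fin n → K) → Fin n → K
  neg : (Fin n → K) → Fin n → K
  zero : Fin n → K
  one : Fin n → K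
  add_poly : ∃ P : Fin n → MvPolynomial (Fin n ⊕ Fin n) K,
    ∀ x y : Fin n → K, ∀ i, add x y i = MvPolynomial.eval (Sum.elim x y) (P i)
  mul_poly : ∃ P : Fin n → MvPolynomial (Fin n ⊕ Fin n) K,
    ∀ x y : Fin n → K, ∀ i, mul x y i = MvPolynomial.eval (Sum.elim x y) (P i)
  neg_poly : ∃ P : Fin n → MvPolynomial (Fin n) K,
    ∀ x : Fin n → K, ∀ i, neg x i = MvPolynomial.eval x (P i)
  zero_mem : zero ∈ carrier
  one_mem : one ∈ carrier
  add_mem : ∀ {x y}, x ∈ carrier → y ∈ carrier → add x y ∈ carrier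
  mul_mem : ∀ {x y}, x ∈ carrier → y ∈ carrier → mul x y ∈ carrier
  neg_mem : ∀ {x}, x ∈ carrier → neg x ∈ carrier
  add_comm' : ∀ x ∈ carrier, ∀ y ∈ carrier, add x y = add y x
  add_assoc' : ∀ x ∈ carrier, ∀ y ∈ carrier, ∀ z ∈ carrier,
    add (add x y) z = add x (add y z)
  zero_add' : ∀ x ∈ carrier, add zero x = x
  neg_add_cancel' : ∀ x ∈ carrier, add (neg x) x = zero
  mul_assoc' : ∀ x ∈ carrier, ∀ y ∈ carrier, ∀ z ∈ carrier,
    mul (mul x y) z = mul x (mul y z)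
  one_mul' : ∀ x ∈ carrier, mul one x = x
  mul_one' : ∀ x ∈ carrier, mul x one = x
  left_distrib' : ∀ x ∈ carrier, ∀ y ∈ carrier, ∀ z ∈ carrier,
    mul x (add y z) = add (mul x y) (mul x z)
  right_distrib' : ∀ x ∈ carrier, ∀ y ∈ carrier, ∀ z ∈ carrier,
    mul (add x y) z = add (mul x z) (mul y z)

namespace AlgebraicRing

variable {K : Type} [Field K] (A : AlgebraicRing K)

/-- The points of the algebraic ring `A`. -/
def Elt : Type := {x : Fin A.n → K // x ∈ A.carrier}

instance : TopologicalSpace A.Elt :=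
  TopologicalSpace.induced (fun x => x.1) (affineZariski K A.n)

instance : Add A.Elt := ⟨fun x y => ⟨A.add x.1 y.1, A.add_mem x.2 y.2⟩⟩
instance : Mul A.Elt := ⟨fun x y => ⟨A.mul x.1 y.1, A.mul_mem x.2 y.2⟩⟩
instance : Neg A.Elt := ⟨fun x => ⟨A.neg x.1, A.neg_mem x.2⟩⟩
instance : Zero A.Elt := ⟨⟨A.zero, A.zero_mem⟩⟩
instance : One A.Elt := ⟨⟨A.one, A.one_mem⟩⟩

instance : AddCommGroup A.Elt where
  add_assoc a b c := Subtype.ext (A.add_assoc' _ a.2 _ b.2 _ c.2)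
  zero_add a := Subtype.ext (A.zero_add' _ a.2)
  add_zero a := Subtype.ext (by
    show A.add a.1 A.zero = a.1
    rw [A.add_comm' _ a.2 _ A.zero_mem]
    exact A.zero_add' _ a.2)
  neg_add_cancel a := Subtype.ext (A.neg_add_cancel' _ a.2)
  add_comm a b := Subtype.ext (A.add_comm' _ a.2 _ b.2)
  nsmul := nsmulRec
  zsmul := zsmulRec

instance : Ring A.Elt :=
  { (inferInstance : AddCommGroup A.Elt) with
    left_distrib := fun a b c => Subtype.ext (A.left_distrib' _ a.2 _ b.2 _ c.2)
    right_distrib := fun a b c => Subtype.ext (A.right_distrib' _ a.2 _ b.2 _ c.2)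
    zero_mul := fun a => by
      have h : (0 : A.Elt) * a + (0 : A.Elt) * a = (0 : A.Elt) * a + 0 := by
        rw [add_zero]
        apply Subtype.ext
        show A.add (A.mul A.zero a.1) (A.mul A.zero a.1) = A.mul A.zero a.1
        rw [← A.right_distrib' _ A.zero_mem _ A.zero_mem _ a.2, A.zero_add' _ A.zero_mem]
      exact add_left_cancel h
    mul_zero := fun a => by
      have h : a * (0 : A.Elt) + a * (0 : A.Elt) = a * (0 : A.Elt) + 0 := by
        rw [add_zero]
        apply Subtype.ext
        show A.add (A.mul a.1 A.zero) (A.mul a.1 A.zero) = A.mul a.1 A.zero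
        rw [← A.left_distrib' _ a.2 _ A.zero_mem _ A.zero_mem, A.zero_add' _ A.zero_mem]
      exact add_left_cancel h
    mul_assoc := fun a b c => Subtype.ext (A.mul_assoc' _ a.2 _ b.2 _ c.2)
    one_mul := fun a => Subtype.ext (A.one_mul' _ a.2)
    mul_one := fun a => Subtype.ext (A.mul_one' _ a.2) }

end AlgebraicRing

/-- A commutative algebraic ring. -/
structure CommAlgebraicRing (K : Type) [Field K] extends AlgebraicRing K where
  mul_comm' : ∀ x ∈ carrier, ∀ y ∈ carrier, mul x y = mul y x

namespace CommAlgebraicRing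

variable {K : Type} [Field K] (A : CommAlgebraicRing K)

/-- The points of the commutative algebraic ring `A`. -/
abbrev Elt : Type := A.toAlgebraicRing.Elt

instance : CommRing A.Elt :=
  { (inferInstance : Ring A.toAlgebraicRing.Elt) with
    mul_comm := fun a b => Subtype.ext (by exact A.mul_comm' _ a.2 _ b.2) }

end CommAlgebraicRing

end



theorem ar_common_eigen {K V ι : Type*} [Field K] [IsAlgClosed K] [AddCommGroup V] [Module K V]
    [FiniteDimensional K V] [Nontrivial V] (T : ι → Module.End K V)
    (hT : ∀ a b, Commute (T a) (T b)) :
    ∃ v : V, v ≠ 0 ∧ ∀ a, ∃ c : K, T a v = c • v := by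
  obtain ⟨W, ⟨hW0, hWi⟩, hmin⟩ := wellFounded_lt.has_min
    {W : Submodule K V | W ≠ ⊥ ∧ ∀ a, ∀ w ∈ W, T a w ∈ W} ⟨⊤, top_ne_bot, by simp⟩
  obtain ⟨v, hvW, hv0⟩ := W.exists_mem_ne_zero_of_ne_bot hW0
  refine ⟨v, hv0, fun a => ?_⟩
  have : Nontrivial W := ⟨⟨v, hvW⟩, 0, by simpa [Subtype.ext_iff] using hv0⟩
  obtain ⟨c, hc⟩ := Module.End.exists_eigenvalue ((T a).restrict (hWi a))
  obtain ⟨w, hw⟩ := hc.exists_hasEigenvector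
  have hw1 : T a w.1 = c • w.1 := by
    have := hw.apply_eq_smul
    simpa [Subtype.ext_iff] using this
  let W' : Submodule K V := W ⊓ LinearMap.ker (T a - c • LinearMap.id)
  have hW' : W' = W := by
    by_contra hne
    refine hmin W' ⟨?_, ?_⟩ (lt_of_le_of_ne inf_le_left hne)
    · intro h
      have : w.1 ∈ W' := ⟨w.2, by simp [hw1]⟩
      rw [h] at this
      exact hw.2 (Subtype.ext (by simpa using this))
    · rintro b x ⟨hx, hx'⟩
      refine ⟨hWi b x hx, ?_⟩
      have h1 : T a x = c • x := by simpa [sub_eq_zero] using hx'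
      have h2 : T a (T b x) = T b (T a x) := LinearMap.congr_fun (hT a b) x
      simp [h2, h1]
  have : v ∈ W' := hW' ▸ hvW
  exact ⟨c, by simpa [sub_eq_zero] using this.2⟩

/-- point derivations at zero -/
def arTan {K R : Type*} [Field K] [CommRing R] (O : Subalgebra K (R → K)) :
    Submodule K (O →ₗ[K] K) where
  carrier := {D | ∀ f g : O, D (f * g) = f.1 0 * D g + g.1 0 * D f}
  add_mem' {D E} hD hE f g := by simp [hD f g, hE f g]; ring
  zero_mem' f g := by simp
  smul_mem' c D hD f g := by simp [hD f g]; ring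

theorem arTan_one {K R : Type*} [Field K] [CommRing R] (O : Subalgebra K (R → K))
    (D : arTan O) : D.1 1 = 0 := by
  have := D.2 1 1
  simpa using this

theorem arTan_findim {K R : Type*} [Field K] [CommRing R] (O : Subalgebra K (R → K))
    (hfg : O.FG) : FiniteDimensional K (arTan O) := by
  have : Algebra.FiniteType K O := O.fg_iff_finiteType.1 hfg
  obtain ⟨t, ht⟩ := (Algebra.FiniteType.out : (⊤ : Subalgebra K O).FG)
  let F : arTan O →ₗ[K] (t → K) :=
    { toFun := fun D i => D.1 i.1, map_add' := fun _ _ => rfl, map_smul' := fun _ _ => rfl }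
  refine FiniteDimensional.of_injective F ?_
  intro D E hDE
  apply Subtype.ext
  refine LinearMap.ext fun f => ?_
  have hf : f ∈ Algebra.adjoin K (t : Set O) := by rw [ht]; trivial
  induction hf using Algebra.adjoin_induction with
  | mem x hx => exact congrFun hDE ⟨x, hx⟩
  | algebraMap r =>
    rw [Algebra.algebraMap_eq_smul_one, map_smul, map_smul, arTan_one, arTan_one]
  | add x y _ _ hx hy => rw [map_add, map_add, hx, hy]
  | mul x y _ _ hx hy => rw [D.2 x y, E.2 x y, hx, hy]

theorem arTan_nontrivial {K R : Type*} [Field K] [CommRing R] [Infinite R]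
    (O : Subalgebra K (R → K)) (hfg : O.FG)
    (hsep : ∀ x, (∀ f ∈ O, f x = f 0) → x = 0)
    (htr : ∀ f ∈ O, ∀ a, (fun x => f (x + a)) ∈ O) : Nontrivial (arTan O) := by
  classical
  have : Algebra.FiniteType K O := O.fg_iff_finiteType.1 hfg
  have : IsNoetherianRing O := Algebra.FiniteType.isNoetherianRing K O
  let ev : O →ₐ[K] K := (Pi.evalAlgHom K (fun _ : R => K) 0).comp O.val
  have hev : ∀ f : O, ev f = f.1 0 := fun f => rfl
  let I : Ideal O := RingHom.ker ev
  have hI : ¬ IsIdempotentElem I := by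
    intro h
    obtain ⟨e, he, heI⟩ := (Ideal.isIdempotentElem_iff_of_fg I (IsNoetherian.noetherian I)).1 h
    have hee : ∀ x, e.1 x * e.1 x = e.1 x := fun x => congrFun (congrArg Subtype.val he) x
    have he0 : e.1 0 = 0 := by
      have : e ∈ I := by rw [heI]; exact Submodule.mem_span_singleton_self e
      exact this
    have hz : ∀ x, x ≠ 0 → e.1 x = 1 := by
      intro x hx
      by_contra hne
      have hx0 : e.1 x = 0 := by
        have : e.1 x * (e.1 x - 1) = 0 := by rw [mul_sub, hee]; ring
        rcases mul_eq_zero.1 this with h | h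
        · exact h
        · exact absurd (sub_eq_zero.1 h) hne
      apply hx
      apply hsep
      intro f hf
      have hm : (⟨f, hf⟩ - algebraMap K O (f 0) : O) ∈ I := by
        show ev _ = 0
        rw [map_sub, AlgHom.commutes, hev]; simp
      rw [heI] at hm
      obtain ⟨g, hg⟩ := Submodule.mem_span_singleton.1 hm
      have := congrFun (congrArg Subtype.val hg) x
      have h2 : g.1 x * e.1 x = f x - f 0 := this
      rw [hx0, mul_zero] at h2
      exact (sub_eq_zero.1 h2.symm)
    -- delta functions
    let δ : R → O := fun a => ⟨fun x => (1 - e).1 (x + -a), htr _ (1 - e).2 _⟩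
    have hδ1 : ∀ a, (δ a).1 a = 1 := by
      intro a
      show 1 - e.1 (a + -a) = 1
      rw [add_neg_cancel, he0, sub_zero]
    have hδ0 : ∀ a b, b ≠ a → (δ a).1 b = 0 := by
      intro a b hab
      show 1 - e.1 (b + -a) = 0
      rw [hz, sub_self]
      rwa [← sub_eq_add_neg, sub_ne_zero]
    obtain ⟨s, hs1, hs2⟩ := Submodule.fg_span_iff_fg_span_finset_subset (R := O) (Set.range δ) |>.1
      (IsNoetherian.noetherian _)
    choose! g hg using hs1
    obtain ⟨b, hb⟩ := Infinite.exists_notMem_finset (s.image g)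
    have hbm : δ b ∈ Submodule.span O (s : Set O) := by
      rw [← hs2]; exact Submodule.subset_span ⟨b, rfl⟩
    have : ∀ f ∈ Submodule.span O (s : Set O), f.1 b = 0 := by
      intro f hf
      induction hf using Submodule.span_induction with
      | mem x hx =>
        rw [← hg hx]
        apply hδ0
        rintro rfl
        exact hb (Finset.mem_image_of_mem g hx)
      | zero => rfl
      | add x y _ _ hx hy => show x.1 b + y.1 b = 0; rw [hx, hy, add_zero]
      | smul a x _ hx => show a.1 b * x.1 b = 0; rw [hx, mul_zero]
    have h1 := this _ hbm
    rw [hδ1] at h1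
    exact one_ne_zero h1
  have hlt : ∃ f ∈ I, f ∉ I * I := by
    by_contra hcon
    push Not at hcon
    exact hI (le_antisymm Ideal.mul_le_left hcon)
  obtain ⟨f, hfI, hf2⟩ := hlt
  obtain ⟨φ, hφ, hker⟩ := Submodule.exists_le_ker_of_notMem
    (p := (I * I).restrictScalars K) (v := f) (fun h => hf2 h)
  let D : O →ₗ[K] K := φ - (LinearMap.toSpanSingleton K K (φ 1)).comp ev.toLinearMap
  have hD : ∀ h : O, D h = φ h - h.1 0 * φ 1 := fun h => by simp [D, hev]
  have hDm : D ∈ arTan O := by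
    intro h k
    have hm : (h - algebraMap K O (h.1 0)) * (k - algebraMap K O (k.1 0)) ∈ I * I := by
      apply Ideal.mul_mem_mul <;>
      · show ev _ = 0
        rw [map_sub, AlgHom.commutes, hev]; simp
    have h0 : φ _ = 0 := hker hm
    have hexp : (h - algebraMap K O (h.1 0)) * (k - algebraMap K O (k.1 0)) =
      h * k - h.1 0 • k - k.1 0 • h + (h.1 0 * k.1 0) • (1 : O) := by
      simp only [Algebra.smul_def, map_mul]; ring
    rw [hexp] at h0
    simp only [map_add, map_sub, map_smul, smul_eq_mul] at h0
    have hk : (h * k).1 0 = h.1 0 * k.1 0 := rfl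
    simp only [hD, hk]
    linear_combination h0
  refine ⟨⟨D, hDm⟩, 0, fun h => ?_⟩
  have h1 : D f = 0 := by rw [show D = 0 from congrArg Subtype.val h]; rfl
  rw [hD, show f.1 0 = 0 from hfI] at h1
  apply hφ
  simpa using h1

theorem ar_core {K R : Type*} [Field K] [IsAlgClosed K] [CommRing R] [Infinite R]
    (O : Subalgebra K (R → K)) (hfg : O.FG)
    (hsep : ∀ x, (∀ f ∈ O, f x = f 0) → x = 0)
    (hadd : ∀ f ∈ O, ∃ (N : ℕ) (u w : Fin N → O), ∀ x y, f (x + y) = ∑ i, (u i).1 x * (w i).1 y)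
    (hmul : ∀ f ∈ O, ∃ (N : ℕ) (u w : Fin N → O), ∀ x y, f (x * y) = ∑ i, (u i).1 x * (w i).1 y) :
    ∃ χ : R →+* K, (χ : R → K) ∈ O := by
  have hL : ∀ f ∈ O, ∀ a, (fun x => f (a * x)) ∈ O := by
    intro f hf a
    obtain ⟨N, u, w, h⟩ := hmul f hf
    have : (fun x => f (a * x)) = ∑ i, (u i).1 a • (w i).1 := by
      ext x; simp [h]
    rw [this]
    exact sum_mem fun i _ => O.smul_mem (w i).2 _
  have htr : ∀ f ∈ O, ∀ a, (fun x => f (x + a)) ∈ O := by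
    intro f hf a
    obtain ⟨N, u, w, h⟩ := hadd f hf
    have : (fun x => f (x + a)) = ∑ i, (u i).1 a • (w i).1 := by
      ext x; simp [add_comm x a, h]
    rw [this]
    exact sum_mem fun i _ => O.smul_mem (w i).2 _
  have := arTan_nontrivial O hfg hsep htr
  have := arTan_findim O hfg
  let L : R → O →ₗ[K] O := fun a =>
    { toFun := fun f => ⟨fun x => f.1 (a * x), hL f.1 f.2 a⟩
      map_add' := fun _ _ => rfl
      map_smul' := fun _ _ => rfl }
  have hLv : ∀ a f x, (L a f).1 x = f.1 (a * x) := fun _ _ _ => rfl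
  have hLm : ∀ a f g, L a (f * g) = L a f * L a g := fun _ _ _ => rfl
  have hLL : ∀ a b f, L a (L b f) = L (b * a) f := fun a b f =>
    Subtype.ext (funext fun x => by simp [hLv, mul_assoc])
  let T : R → Module.End K (arTan O) := fun a =>
    { toFun := fun D => ⟨D.1.comp (L a), fun f g => by
        simp [hLm, D.2 (L a f) (L a g), hLv]⟩
      map_add' := fun _ _ => rfl
      map_smul' := fun _ _ => rfl }
  have hTv : ∀ a D f, (T a D).1 f = D.1 (L a f) := fun _ _ _ => rfl
  obtain ⟨D, hD0, hDe⟩ := ar_common_eigen (K := K) (V := arTan O) T (by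
    intro a b
    show T a * T b = T b * T a
    refine LinearMap.ext fun D => Subtype.ext (LinearMap.ext fun f => ?_)
    simp only [Module.End.mul_apply, hTv, hLL, mul_comm])
  choose χ hχ using hDe
  have hχ' : ∀ a f, D.1 (L a f) = χ a * D.1 f := by
    intro a f
    rw [← hTv, hχ]; rfl
  obtain ⟨f, hf⟩ : ∃ f, D.1 f ≠ 0 := by
    by_contra h
    push Not at h
    exact hD0 (Subtype.ext (LinearMap.ext h))
  have hvan : ∀ g h : O, g.1 0 = 0 → h.1 0 = 0 → D.1 (g * h) = 0 := by
    intro g h hg hh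
    rw [D.2 g h, hg, hh]; ring
  have haddD : ∀ a b, D.1 (L (a + b) f) = D.1 (L a f) + D.1 (L b f) := by
    intro a b
    obtain ⟨N, u, w, h⟩ := hadd f.1 f.2
    have key : L (a + b) f + f.1 0 • (1 : O) = L a f + L b f +
        ∑ i, (L a (u i) - (u i).1 0 • (1 : O)) * (L b (w i) - (w i).1 0 • (1 : O)) := by
      apply Subtype.ext
      funext x
      have e1 := h (a * x) (b * x)
      have e2 := h (a * x) 0
      have e3 := h 0 (b * x)
      have e4 := h 0 0
      rw [← add_mul] at e1
      rw [add_zero] at e2 e4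
      rw [zero_add] at e3
      have : f.1 ((a + b) * x) + f.1 0 * 1 = f.1 (a * x) + f.1 (b * x) +
        ∑ i, ((u i).1 (a * x) - (u i).1 0 * 1) * ((w i).1 (b * x) - (w i).1 0 * 1) := by
        rw [e1, e2, e3, e4]
        simp only [mul_one, ← Finset.sum_add_distrib]
        exact Finset.sum_congr rfl fun i _ => by ring
      simpa [hLv] using this
    have := congrArg D.1 key
    rw [map_add, map_add, map_add, map_smul, arTan_one, map_sum, Finset.sum_eq_zero] at this
    · simpa using this
    · intro i _
      apply hvan <;> simp [hLv]
  refine ⟨{ toFun := χ, map_one' := ?_, map_mul' := ?_, map_zero' := ?_, map_add' := ?_ }, ?_⟩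
  · apply mul_right_cancel₀ hf
    rw [← hχ', one_mul]
    congr 1
    exact Subtype.ext (funext fun x => by simp [hLv])
  · intro a b
    apply mul_right_cancel₀ hf
    rw [← hχ', mul_comm a b, ← hLL, hχ', hχ', mul_assoc]
  · apply mul_right_cancel₀ hf
    have := haddD 0 0
    rw [add_zero] at this
    rw [← hχ', zero_mul]
    simpa using this
  · intro a b
    apply mul_right_cancel₀ hf
    rw [← hχ', haddD, hχ', hχ']; ring
  · obtain ⟨N, u, w, h⟩ := hmul f.1 f.2
    have : χ = ∑ i, (D.1 (w i) / D.1 f) • (u i).1 := by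
      funext a
      apply mul_right_cancel₀ hf
      rw [← hχ']
      have : L a f = ∑ i, (u i).1 a • w i := by
        apply Subtype.ext; funext x
        simp [hLv, h]
      rw [this, map_sum]
      simp only [map_smul, smul_eq_mul, Finset.sum_apply, Pi.smul_apply, Finset.sum_mul]
      exact Finset.sum_congr rfl fun i _ => by field_simp
    show χ ∈ O
    rw [this]
    exact sum_mem fun i _ => O.smul_mem (u i).2 _

theorem ar_split {K : Type*} [Field K] {n : ℕ} (Q : MvPolynomial (Fin n ⊕ Fin n) K) :
    ∃ (N : ℕ) (u w : Fin N → MvPolynomial (Fin n) K), ∀ x y : Fin n → K,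
      MvPolynomial.eval (Sum.elim x y) Q =
        ∑ i, MvPolynomial.eval x (u i) * MvPolynomial.eval y (w i) := by
  classical
  let σ := Q.support.equivFin
  refine ⟨Q.support.card,
    fun i => MvPolynomial.C (Q.coeff (σ.symm i).1) *
      ∏ j, MvPolynomial.X j ^ ((σ.symm i).1 (Sum.inl j)),
    fun i => ∏ j, MvPolynomial.X j ^ ((σ.symm i).1 (Sum.inr j)), fun x y => ?_⟩
  rw [MvPolynomial.eval_eq', ← Finset.sum_coe_sort, ← Equiv.sum_comp σ.symm]
  refine Finset.sum_congr rfl fun i _ => ?_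
  simp [Fintype.prod_sum_type, mul_assoc]

theorem ar_exists_hom {K R : Type*} [Field K] [IsAlgClosed K] [CommRing R] [Infinite R] {n : ℕ}
    (v : R → Fin n → K) (hv : Function.Injective v)
    (Pa Pm : Fin n → MvPolynomial (Fin n ⊕ Fin n) K)
    (ha : ∀ x y i, v (x + y) i = MvPolynomial.eval (Sum.elim (v x) (v y)) (Pa i))
    (hm : ∀ x y i, v (x * y) i = MvPolynomial.eval (Sum.elim (v x) (v y)) (Pm i)) :
    ∃ (χ : R →+* K) (P : MvPolynomial (Fin n) K), ∀ r, χ r = MvPolynomial.eval (v r) P := by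
  let Φ : MvPolynomial (Fin n) K →ₐ[K] (R → K) := MvPolynomial.aeval (fun i r => v r i)
  have hΦ : ∀ p r, Φ p r = MvPolynomial.eval (v r) p := by
    intro p r
    induction p using MvPolynomial.induction_on with
    | C a => simp [Φ]
    | add p q hp hq => simp [hp, hq]
    | mul_X p i hp => rw [map_mul, map_mul, Pi.mul_apply, hp]; simp [Φ]
  have hcomp : ∀ (Q : Fin n → MvPolynomial (Fin n ⊕ Fin n) K) (op : R → R → R)
      (_ : ∀ x y i, v (op x y) i = MvPolynomial.eval (Sum.elim (v x) (v y)) (Q i)),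
      ∀ f ∈ Φ.range, ∃ (N : ℕ) (u w : Fin N → Φ.range),
        ∀ x y, f (op x y) = ∑ i, (u i).1 x * (w i).1 y := by
    rintro Q op hop f ⟨p, rfl⟩
    obtain ⟨N, u, w, h⟩ := ar_split (MvPolynomial.bind₁ Q p)
    refine ⟨N, fun i => ⟨Φ (u i), u i, rfl⟩, fun i => ⟨Φ (w i), w i, rfl⟩, fun x y => ?_⟩
    simp only [hΦ]
    rw [← h]
    have hv : v (op x y) = fun i => MvPolynomial.eval (Sum.elim (v x) (v y)) (Q i) :=
      funext (hop x y)
    show Φ p (op x y) = _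
    rw [hΦ, hv]
    exact (MvPolynomial.eval₂Hom_bind₁ (RingHom.id K) (Sum.elim (v x) (v y)) Q p).symm
  have hfg : Φ.range.FG := by
    rw [← Algebra.map_top]
    exact Subalgebra.FG.map _ Algebra.FiniteType.out
  obtain ⟨χ, P, hP⟩ := ar_core Φ.range hfg (by
    intro x hx
    apply hv
    funext i
    have := hx (Φ (MvPolynomial.X i)) ⟨_, rfl⟩
    simpa [hΦ] using this) (hcomp Pa (· + ·) ha) (hcomp Pm (· * ·) hm)
  exact ⟨χ, P, fun r => by rw [← hΦ]; exact (congrFun hP r).symm⟩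

theorem ar_surj (K : Type) [Field K] [IsAlgClosed K] (A : CommAlgebraicRing K)
    (χ : A.Elt →+* K) (P : MvPolynomial (Fin A.n) K)
    (hP : ∀ x : A.Elt, χ x = MvPolynomial.eval x.1 P) (hinf : (Set.range χ).Infinite) :
    Function.Surjective χ := by
  classical
  intro t
  by_contra ht
  push Not at ht
  obtain ⟨S, hS⟩ := A.carrier_closed
  -- the inverse of `P - t`
  obtain ⟨q, hq⟩ : ∃ q : MvPolynomial (Fin A.n) K, ∀ x : A.Elt,
      MvPolynomial.eval x.1 q * (χ x - t) = 1 := by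
    let I : Ideal (MvPolynomial (Fin A.n) K) := Ideal.span S ⊔ Ideal.span {P - MvPolynomial.C t}
    have hz : MvPolynomial.zeroLocus K I = ∅ := by
      rw [Set.eq_empty_iff_forall_notMem]
      intro x hx
      have hxc : x ∈ A.carrier := by
        rw [hS]
        intro p hp
        exact hx p (Ideal.mem_sup_left (Ideal.subset_span hp))
      have h2 := hx _ (Ideal.mem_sup_right (Ideal.mem_span_singleton_self _))
      apply ht ⟨x, hxc⟩
      refine (hP _).trans ?_
      have h3 : MvPolynomial.eval x (P - MvPolynomial.C t) = 0 := h2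
      rw [map_sub, MvPolynomial.eval_C, sub_eq_zero] at h3
      exact h3
    have hone : (1 : MvPolynomial (Fin A.n) K) ∈ I.radical := by
      rw [← MvPolynomial.vanishingIdeal_zeroLocus_eq_radical (K := K), hz]
      intro x hx
      exact absurd hx (Set.notMem_empty x)
    obtain ⟨k, hk⟩ := hone
    rw [one_pow] at hk
    obtain ⟨s, hs, b, hb, hsb⟩ := Submodule.mem_sup.1 hk
    obtain ⟨q, rfl⟩ := Ideal.mem_span_singleton'.1 hb
    refine ⟨q, fun x => ?_⟩
    have hs0 : MvPolynomial.eval x.1 s = 0 := by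
      have : Ideal.span S ≤ RingHom.ker (MvPolynomial.eval x.1) := by
        rw [Ideal.span_le]
        intro p hp
        have hx : x.1 ∈ {x | ∀ p ∈ S, MvPolynomial.eval x p = 0} :=
          Set.mem_of_mem_of_subset x.2 hS.le
        exact hx p hp
      exact this hs
    have := congrArg (MvPolynomial.eval x.1) hsb
    simpa [hs0, hP] using this
  obtain ⟨Pa, hPa⟩ := A.add_poly
  obtain ⟨N, u, w, huw⟩ := ar_split (MvPolynomial.bind₁ Pa q)
  have hadd : ∀ x a : A.Elt, MvPolynomial.eval (x + a).1 q =
      ∑ i, MvPolynomial.eval x.1 (u i) * MvPolynomial.eval a.1 (w i) := by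
    intro x a
    rw [← huw]
    have hv : (x + a).1 = fun i => MvPolynomial.eval (Sum.elim x.1 a.1) (Pa i) :=
      funext (hPa x.1 a.1)
    rw [hv]
    exact (MvPolynomial.eval₂Hom_bind₁ (RingHom.id K) (Sum.elim x.1 a.1) Pa q).symm
  -- distinct points
  let c : Fin (N + 1) → K := fun j => (hinf.natEmbedding _ j.1).1
  have hc : Function.Injective c := fun i j h =>
    Fin.ext ((hinf.natEmbedding _).injective (Subtype.ext h))
  have hcr : ∀ j, ∃ a, χ a = c j := fun j => (hinf.natEmbedding _ j.1).2
  choose a ha using hcr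
  let F : (Fin (N + 1) → K) →ₗ[K] (Fin N → K) :=
    Matrix.mulVecLin (Matrix.of fun i j => MvPolynomial.eval (a j).1 (w i))
  have hker := LinearMap.ker_ne_bot_of_finrank_lt (f := F) (by simp)
  obtain ⟨l, hl, hl0⟩ := Submodule.exists_mem_ne_zero_of_ne_bot hker
  have hl1 : ∀ i, ∑ j, MvPolynomial.eval (a j).1 (w i) * l j = 0 := fun i =>
    congrFun (show F l = 0 from hl) i
  have hrel : ∀ x : A.Elt, ∑ j, l j * MvPolynomial.eval (x + a j).1 q = 0 := by
    intro x
    simp only [hadd, Finset.mul_sum]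
    rw [Finset.sum_comm]
    refine Finset.sum_eq_zero fun i _ => ?_
    have := hl1 i
    calc _ = MvPolynomial.eval x.1 (u i) * ∑ j, MvPolynomial.eval (a j).1 (w i) * l j := by
          rw [Finset.mul_sum]; exact Finset.sum_congr rfl fun j _ => by ring
      _ = 0 := by rw [this, mul_zero]
  let G : Polynomial K := ∑ j, Polynomial.C (l j) *
    ∏ k ∈ Finset.univ.erase j, (Polynomial.X + Polynomial.C (c k - t))
  have hG : G = 0 := by
    apply Polynomial.eq_zero_of_infinite_isRoot
    refine hinf.mono ?_
    rintro _ ⟨x, rfl⟩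
    show G.eval (χ x) = 0
    have h1 : ∀ j, MvPolynomial.eval (x + a j).1 q * (χ x + (c j - t)) = 1 := by
      intro j
      have := hq (x + a j)
      rw [map_add, ha] at this
      rw [← this]; ring
    have h2 : G.eval (χ x) = (∏ k, (χ x + (c k - t))) *
        ∑ j, l j * MvPolynomial.eval (x + a j).1 q := by
      rw [Finset.mul_sum]
      simp only [G, Polynomial.eval_finsetSum, Polynomial.eval_mul, Polynomial.eval_C,
        Polynomial.eval_prod, Polynomial.eval_add, Polynomial.eval_X]
      refine Finset.sum_congr rfl fun j _ => ?_
      rw [← Finset.mul_prod_erase _ _ (Finset.mem_univ j)]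
      linear_combination (-(l j * ∏ k ∈ Finset.univ.erase j, (χ x + (c k - t)))) * h1 j
    rw [h2, hrel, mul_zero]
  apply hl0
  funext j
  have h3 : G.eval (t - c j) = 0 := by rw [hG]; simp
  simp only [G, Polynomial.eval_finsetSum, Polynomial.eval_mul, Polynomial.eval_C,
        Polynomial.eval_prod, Polynomial.eval_add, Polynomial.eval_X] at h3
  rw [Finset.sum_eq_single j] at h3
  · rcases mul_eq_zero.1 h3 with h | h
    · exact h
    · obtain ⟨k, hk, hk0⟩ := Finset.prod_eq_zero_iff.1 h
      exact absurd (hc (show c k = c j by linear_combination hk0)) (Finset.ne_of_mem_erase hk)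
  · intro i _ hij
    rw [Finset.prod_eq_zero (i := j), mul_zero]
    · simp [hij.symm]
    · ring
  · simp

theorem ar_residue (K : Type) [Field K] [IsAlgClosed K] (A : CommAlgebraicRing K)
    [IsArtinianRing A.Elt] (m : Ideal A.Elt) [hm : m.IsMaximal] [Infinite (A.Elt ⧸ m)] :
    ∃ χ : A.Elt →+* K, Function.Surjective χ ∧ RingHom.ker χ = m ∧
      ∃ P : MvPolynomial (Fin A.n) K, ∀ x : A.Elt, χ x = MvPolynomial.eval x.1 P := by
  obtain ⟨k, hk⟩ := IsArtinian.monotone_stabilizes (R := A.Elt) (M := A.Elt)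
    ⟨fun k => OrderDual.toDual (m ^ (k + 1)),
      fun i j hij => Ideal.pow_le_pow_right (Nat.add_le_add_right hij 1)⟩
  have hid : IsIdempotentElem (m ^ (k + 1)) := by
    have h1 : m ^ (k + 1) = m ^ (k + 1 + k + 1) := hk (k + 1 + k) (by omega)
    show m ^ (k + 1) * m ^ (k + 1) = m ^ (k + 1)
    rw [← pow_add]
    exact h1.symm
  obtain ⟨g, hg, hgI⟩ := (Ideal.isIdempotentElem_iff_of_fg _
    (IsNoetherian.noetherian (m ^ (k + 1)))).1 hid
  set I := m ^ (k + 1) with hI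
  have hIm : I ≤ m := Ideal.pow_le_self (by omega)
  have hgI' : ∀ x, x ∈ I ↔ (1 - g) * x = 0 := by
    intro x
    rw [hgI]
    constructor
    · intro h
      obtain ⟨y, rfl⟩ := Submodule.mem_span_singleton.1 h
      show (1 - g) * (y * g) = 0
      have : g * g = g := hg
      linear_combination (-y) * this
    · intro h
      refine Submodule.mem_span_singleton.2 ⟨x, ?_⟩
      show x * g = x
      linear_combination -h
  let ι : A.Elt ⧸ I → A.Elt := fun y => (1 - g) * Quotient.out y
  have hι : ∀ x, ι (Ideal.Quotient.mk I x) = (1 - g) * x := by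
    intro x
    have : Ideal.Quotient.mk I (Quotient.out (Ideal.Quotient.mk I x)) = Ideal.Quotient.mk I x :=
      Quotient.out_eq _
    have h2 := (hgI' _).1 (Ideal.Quotient.eq.1 this)
    show (1 - g) * _ = _
    linear_combination h2
  have hιinj : Function.Injective ι := by
    intro x y hxy
    obtain ⟨x, rfl⟩ := Ideal.Quotient.mk_surjective x
    obtain ⟨y, rfl⟩ := Ideal.Quotient.mk_surjective y
    rw [hι, hι] at hxy
    rw [Ideal.Quotient.eq, hgI']
    linear_combination hxy
  have hιadd : ∀ x y, ι (x + y) = ι x + ι y := by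
    intro x y
    obtain ⟨x, rfl⟩ := Ideal.Quotient.mk_surjective x
    obtain ⟨y, rfl⟩ := Ideal.Quotient.mk_surjective y
    rw [← map_add, hι, hι, hι, mul_add]
  have hιmul : ∀ x y, ι (x * y) = ι x * ι y := by
    intro x y
    obtain ⟨x, rfl⟩ := Ideal.Quotient.mk_surjective x
    obtain ⟨y, rfl⟩ := Ideal.Quotient.mk_surjective y
    rw [← map_mul, hι, hι, hι]
    have : g * g = g := hg
    linear_combination (-(x * y)) * this
  have : Infinite (A.Elt ⧸ I) := Infinite.of_surjective (Ideal.Quotient.factor hIm)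
    (Ideal.Quotient.factor_surjective hIm)
  obtain ⟨Pa, hPa⟩ := A.add_poly
  obtain ⟨Pm, hPm⟩ := A.mul_poly
  obtain ⟨χ, P, hP⟩ := ar_exists_hom (K := K) (fun y => (ι y).1)
    (fun x y h => hιinj (Subtype.ext h)) Pa Pm
    (fun x y i => by rw [hιadd]; exact hPa _ _ i)
    (fun x y i => by rw [hιmul]; exact hPm _ _ i)
  let ψ : A.Elt →+* K := χ.comp (Ideal.Quotient.mk I)
  have hle : m ≤ RingHom.ker ψ := by
    have hp : (RingHom.ker ψ).IsPrime := RingHom.ker_isPrime ψ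
    refine hp.le_of_pow_le (n := k + 1) ?_
    intro x hx
    show χ (Ideal.Quotient.mk I x) = 0
    rw [Ideal.Quotient.eq_zero_iff_mem.2 hx, map_zero]
  have hker : RingHom.ker ψ = m := (hm.eq_of_le (RingHom.ker_ne_top ψ) hle).symm
  let Q : MvPolynomial (Fin A.n) K := MvPolynomial.bind₁ (fun i =>
    MvPolynomial.bind₁ (Sum.elim (fun j => MvPolynomial.C ((1 - g).1 j)) MvPolynomial.X) (Pm i)) P
  have hQ : ∀ x : A.Elt, ψ x = MvPolynomial.eval x.1 Q := by
    intro x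
    show χ (Ideal.Quotient.mk I x) = _
    rw [hP, hι]
    have hv : ((1 - g) * x).1 = fun i => MvPolynomial.eval (Sum.elim (1 - g).1 x.1) (Pm i) :=
      funext (hPm (1 - g).1 x.1)
    rw [hv]
    have e := MvPolynomial.eval₂Hom_bind₁ (RingHom.id K) x.1 (fun i =>
      MvPolynomial.bind₁ (Sum.elim (fun j => MvPolynomial.C ((1 - g).1 j)) MvPolynomial.X)
        (Pm i)) P
    refine Eq.trans ?_ e.symm
    show MvPolynomial.eval _ P = MvPolynomial.eval _ P
    congr 2
    funext i
    have e2 := MvPolynomial.eval₂Hom_bind₁ (RingHom.id K) x.1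
      (Sum.elim (fun j => MvPolynomial.C ((1 - g).1 j)) MvPolynomial.X) (Pm i)
    refine Eq.trans ?_ e2.symm
    show MvPolynomial.eval _ (Pm i) = MvPolynomial.eval _ (Pm i)
    congr 2
    funext j
    rcases j with j | j <;> simp
  refine ⟨ψ, ar_surj K A ψ Q hQ ?_, hker, Q, hQ⟩
  have e := (Ideal.quotEquivOfEq hker.symm).trans (RingHom.quotientKerEquivRange ψ)
  have : Infinite ψ.range := Infinite.of_injective e e.injective
  exact Set.infinite_coe_iff.1 this


/-- Let `A` be a commutative artinian algebraic ring over an algebraically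
closed field `K`, with Jacobson radical `J`.  Then `A/J ≅ (K,+,⬝)^n ⊕ C` as rings, where
`C` is a finite (non-unital sub)ring, and the isomorphism is induced by a regular
(polynomial) map on `A`.  In particular `A/J` virtually comes from an algebra. -/
theorem stmt_15 (K : Type) [Field K] [IsAlgClosed K] (A : CommAlgebraicRing K)
    [IsArtinianRing A.Elt] :
    ∃ (m : ℕ) (C : NonUnitalSubring (A.Elt ⧸ Ideal.jacobson (⊥ : Ideal A.Elt))),
      (C : Set (A.Elt ⧸ Ideal.jacobson (⊥ : Ideal A.Elt))).Finite ∧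
      ∃ e : (A.Elt ⧸ Ideal.jacobson (⊥ : Ideal A.Elt)) ≃+* ((Fin m → K) × C),
        ∃ P : Fin m → MvPolynomial (Fin A.n) K,
          ∀ x : A.Elt, ∀ i,
            (e (Ideal.Quotient.mk (Ideal.jacobson (⊥ : Ideal A.Elt)) x)).1 i =
              MvPolynomial.eval x.1 (P i) := by
  classical
  set J := Ideal.jacobson (⊥ : Ideal A.Elt) with hJ
  have hJm : ∀ x : A.Elt, x ∈ J ↔ ∀ m : MaximalSpectrum A.Elt, x ∈ m.asIdeal := by
    intro x
    rw [hJ, Ideal.jacobson, Ideal.mem_sInf]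
    exact ⟨fun h m => h ⟨bot_le, m.isMaximal⟩, fun h I hI => h ⟨I, hI.2⟩⟩
  have hcop : Pairwise (Function.onFun IsCoprime
      (fun m : MaximalSpectrum A.Elt => m.asIdeal)) := by
    intro m m' hne
    rw [Function.onFun, Ideal.isCoprime_iff_sup_eq]
    exact Ideal.IsMaximal.coprime_of_ne m.isMaximal m'.isMaximal
      (fun h => hne (MaximalSpectrum.ext h))
  have hcrt : ∀ z : MaximalSpectrum A.Elt → A.Elt, ∃ r : A.Elt, ∀ m : MaximalSpectrum A.Elt,
      r - z m ∈ m.asIdeal := by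
    intro z
    obtain ⟨r, hr⟩ := Ideal.pi_quotient_surjective hcop
      (fun m => Ideal.Quotient.mk m.asIdeal (z m))
    exact ⟨r, fun m => Ideal.Quotient.eq.1 (hr m)⟩
  let s : Type := {m : MaximalSpectrum A.Elt // Infinite (A.Elt ⧸ m.asIdeal)}
  have hsfin : Finite s := inferInstanceAs
    (Finite {m : MaximalSpectrum A.Elt // Infinite (A.Elt ⧸ m.asIdeal)})
  obtain ⟨k, ⟨σ⟩⟩ := Finite.exists_equiv_fin s
  have hres : ∀ i : Fin k, ∃ χ : A.Elt →+* K, Function.Surjective χ ∧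
      RingHom.ker χ = (σ.symm i).1.asIdeal ∧
      ∃ P : MvPolynomial (Fin A.n) K, ∀ x : A.Elt, χ x = MvPolynomial.eval x.1 P := by
    intro i
    have := (σ.symm i).2
    have := (σ.symm i).1.isMaximal
    exact ar_residue K A (σ.symm i).1.asIdeal
  choose χ hχs hχk P hP using hres
  have hχ0 : ∀ i x, χ i x = 0 ↔ x ∈ (σ.symm i).1.asIdeal := by
    intro i x
    rw [← hχk i]; rfl
  let φ : (A.Elt ⧸ J) →+* (Fin k → K) := Ideal.Quotient.lift J (RingHom.pi χ) (by
    intro x hx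
    funext i
    exact (hχ0 i x).2 ((hJm x).1 hx _))
  have hφ : ∀ x i, φ (Ideal.Quotient.mk J x) i = χ i x := fun x i => rfl
  let C : NonUnitalSubring (A.Elt ⧸ J) :=
    { carrier := {y | φ y = 0}
      add_mem' := fun {x y} hx hy => by
        show φ (x + y) = 0
        rw [map_add, show φ x = 0 from hx, show φ y = 0 from hy, add_zero]
      zero_mem' := map_zero φ
      neg_mem' := fun {x} hx => by
        show φ (-x) = 0
        rw [map_neg, show φ x = 0 from hx, neg_zero]
      mul_mem' := fun {x y} hx hy => by
        show φ (x * y) = 0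
        rw [map_mul, show φ x = 0 from hx, zero_mul] }
  have hC : ∀ y, y ∈ C ↔ φ y = 0 := fun y => Iff.rfl
  -- membership in the infinite maximal ideals
  have hφinf : ∀ x, φ (Ideal.Quotient.mk J x) = 0 ↔
      ∀ m : MaximalSpectrum A.Elt, Infinite (A.Elt ⧸ m.asIdeal) → x ∈ m.asIdeal := by
    intro x
    constructor
    · intro h m hm
      have := (hχ0 (σ ⟨m, hm⟩) x).1 (by rw [← hφ, h]; rfl)
      rwa [Equiv.symm_apply_apply] at this
    · intro h
      funext i
      exact (hχ0 i x).2 (h _ (σ.symm i).2)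
  obtain ⟨e, he⟩ := hcrt (fun m => if Infinite (A.Elt ⧸ m.asIdeal) then 0 else 1)
  have he0 : ∀ m : MaximalSpectrum A.Elt, Infinite (A.Elt ⧸ m.asIdeal) → e ∈ m.asIdeal := by
    intro m hm
    have := he m
    rwa [if_pos hm, sub_zero] at this
  have he1 : ∀ m : MaximalSpectrum A.Elt, ¬ Infinite (A.Elt ⧸ m.asIdeal) →
      e - 1 ∈ m.asIdeal := by
    intro m hm
    have := he m
    rwa [if_neg hm] at this
  let ε : A.Elt ⧸ J := Ideal.Quotient.mk J e
  have hφε : φ ε = 0 := (hφinf e).2 he0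
  have hεC : ∀ y, φ y = 0 → ε * y = y := by
    intro y hy
    obtain ⟨y, rfl⟩ := Ideal.Quotient.mk_surjective y
    rw [hφinf] at hy
    rw [← map_mul, Ideal.Quotient.eq, hJm]
    intro m
    have h1 : e * y - y = (e - 1) * y := by ring
    rw [h1]
    by_cases hm : Infinite (A.Elt ⧸ m.asIdeal)
    · exact Ideal.mul_mem_left _ _ (hy m hm)
    · exact Ideal.mul_mem_right _ _ (he1 m hm)
  have hφsurj : Function.Surjective φ := by
    intro z
    choose x hx using fun i => hχs i (z i)
    obtain ⟨r, hr⟩ := hcrt (fun m => if hm : Infinite (A.Elt ⧸ m.asIdeal)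
      then x (σ ⟨m, hm⟩) else 0)
    refine ⟨Ideal.Quotient.mk J r, ?_⟩
    funext i
    have h1 := hr (σ.symm i).1
    rw [dif_pos (σ.symm i).2] at h1
    have h2 := (hχ0 i _).2 h1
    rw [map_sub, sub_eq_zero] at h2
    rw [hφ, h2]
    have h3 : σ ⟨(σ.symm i).1, (σ.symm i).2⟩ = i := σ.apply_symm_apply i
    rw [h3, hx]
  let E : (A.Elt ⧸ J) → (Fin k → K) × C := fun y =>
    (φ y, ⟨ε * y, (hC _).2 (by rw [map_mul, hφε, zero_mul])⟩)
  have hEinj : Function.Injective E := by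
    intro y z hyz
    have h1 : φ y = φ z := congrArg Prod.fst hyz
    have h2 : ε * y = ε * z := congrArg (fun p => p.2.1) hyz
    have h3 : φ (y - z) = 0 := by rw [map_sub, h1, sub_self]
    have h4 := hεC _ h3
    rw [mul_sub, h2, sub_self] at h4
    exact sub_eq_zero.1 h4.symm
  have hEsurj : Function.Surjective E := by
    rintro ⟨z, c, hc⟩
    obtain ⟨y, rfl⟩ := hφsurj z
    have hc' : φ c = 0 := hc
    have hεε := hεC ε hφε
    have hεc := hεC c hc'
    refine ⟨(1 - ε) * y + c, Prod.ext ?_ (Subtype.ext ?_)⟩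
    · show φ _ = φ y
      rw [map_add, map_mul, map_sub, map_one, hφε, hc']; ring
    · show ε * ((1 - ε) * y + c) = c
      linear_combination (-y) * hεε + hεc
  let E' : (A.Elt ⧸ J) ≃+* ((Fin k → K) × C) :=
    { Equiv.ofBijective E ⟨hEinj, hEsurj⟩ with
      map_add' := fun y z => Prod.ext (map_add φ y z) (Subtype.ext (mul_add ε y z))
      map_mul' := fun y z => Prod.ext (map_mul φ y z) (Subtype.ext (by
        show ε * (y * z) = (ε * y) * (ε * z)
        have hεε := hεC ε hφε
        linear_combination (-(y * z)) * hεε)) }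
  refine ⟨k, C, ?_, E', P, fun x i => hP i x⟩
  -- finiteness
  let f : MaximalSpectrum A.Elt → Type := fun m => A.Elt ⧸ m.asIdeal
  let t : Type := {m : MaximalSpectrum A.Elt // ¬ Infinite (A.Elt ⧸ m.asIdeal)}
  have htfin : Finite t := inferInstanceAs
    (Finite {m : MaximalSpectrum A.Elt // ¬ Infinite (A.Elt ⧸ m.asIdeal)})
  have hf : ∀ m : t, Finite (A.Elt ⧸ m.1.asIdeal) := fun m => not_infinite_iff_finite.1 m.2
  have hJle : ∀ m : MaximalSpectrum A.Elt, J ≤ m.asIdeal := fun m x hx => (hJm x).1 hx m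
  let g : C → (∀ m : t, A.Elt ⧸ m.1.asIdeal) := fun c m =>
    Ideal.Quotient.factor (hJle m.1) c.1
  have hg : Function.Injective g := by
    rintro ⟨c, hc⟩ ⟨d, hd⟩ hcd
    apply Subtype.ext
    show c = d
    have h0 : φ (c - d) = 0 := by
      rw [map_sub, show φ c = 0 from hc, show φ d = 0 from hd, sub_zero]
    obtain ⟨c, rfl⟩ := Ideal.Quotient.mk_surjective c
    obtain ⟨d, rfl⟩ := Ideal.Quotient.mk_surjective d
    rw [← map_sub, hφinf] at h0
    rw [Ideal.Quotient.eq, hJm]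
    intro m
    by_cases hm : Infinite (A.Elt ⧸ m.asIdeal)
    · exact h0 m hm
    · exact Ideal.Quotient.eq.1 (congrFun hcd ⟨m, hm⟩)
  have : Finite C := Finite.of_injective g hg
  exact Set.toFinite (C : Set (A.Elt ⧸ J))
end

section
/- Let $X$ be a complete irreducible variety over an algebraically closed field $K$, equipped with regular maps $\alpha, \mu : X \times X \to X$ satisfying the algebraic-ring axioms (I)-(III) (additive commutative algebraic group structure, associative multiplication, two-sided distributivity), but not necessarily possessing a multiplicative identity. Then the multiplication is identically zero: $\mu(x,y) = 0_X$ for all $x, y \in X$. -/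
open CategoryTheory Limits AlgebraicGeometry

noncomputable section

/-- Given a scheme `X` over a base `S` (via `s : X ⟶ S`) and a binary operation
`μ : X ×_S X ⟶ X`, the induced operation on `T`-valued points `x, y : T ⟶ X`
lying over a common map to `S`. -/
def ptOp {X S : Scheme} (s : X ⟶ S) (μ : pullback s s ⟶ X)
    {T : Scheme} (x y : T ⟶ X) (h : x ≫ s = y ≫ s) : T ⟶ X :=
  pullback.lift x y h ≫ μ

end


@[ext] structure Heis (A : Type) [AddCommGroup A] (m : A →+ A →+ A) where
  a : A
  b : A
  c : A

instance heisGroup (A : Type) [AddCommGroup A] (m : A →+ A →+ A) : Group (Heis A m) where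
  mul x y := ⟨x.a + y.a, x.b + y.b, x.c + y.c + m x.a y.b⟩
  one := ⟨0, 0, 0⟩
  inv x := ⟨-x.a, -x.b, -x.c + m x.a x.b⟩
  mul_assoc x y w := by
    change Heis.mk _ _ _ = Heis.mk _ _ _
    ext <;> simp [HMul.hMul] <;> abel
  one_mul x := by
    change Heis.mk _ _ _ = _
    ext
    · exact zero_add _
    · exact zero_add _
    · change (0 : A) + x.c + m 0 x.b = _
      simp
  mul_one x := by
    change Heis.mk _ _ _ = _
    ext
    · exact add_zero _
    · exact add_zero _
    · change x.c + (0 : A) + m x.a 0 = _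
      simp
  inv_mul_cancel x := by
    change Heis.mk _ _ _ = Heis.mk 0 0 0
    ext <;> simp

section
open MonoidalCategory CartesianMonoidalCategory MonObj

theorem lift_mul_comm {C : Type 1} [Category.{0} C] [CartesianMonoidalCategory C] [BraidedCategory C]
    (G : C) [MonObj G] [IsCommMonObj G] {T : C} (a b : T ⟶ G) : lift a b ≫ μ = lift b a ≫ μ := by
  conv_lhs => rw [← IsCommMonObj.mul_comm G, ← Category.assoc]
  congr 1
  ext <;> simp

theorem heis_zero {C : Type 1} [Category.{0} C] [CartesianMonoidalCategory C] [BraidedCategory C] (X : C)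
    [∀ T : C, AddCommGroup (T ⟶ X)]
    (hadd : ∀ {T T' : C} (f : T' ⟶ T) (a b : T ⟶ X), f ≫ (a + b) = f ≫ a + f ≫ b)
    (m : ∀ T : C, (T ⟶ X) →+ (T ⟶ X) →+ (T ⟶ X))
    (hm : ∀ {T T' : C} (f : T' ⟶ T) (a b : T ⟶ X), f ≫ m T a b = m T' (f ≫ a) (f ≫ b))
    (H : ∀ (_ : GrpObj (X ⊗ (X ⊗ X))), IsCommMonObj (X ⊗ (X ⊗ X)))
    (T : C) (x y : T ⟶ X) : m T x y = 0 := by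
  let F : Cᵒᵖ ⥤ GrpCat.{0} :=
    { obj := fun T => GrpCat.of (Heis (T.unop ⟶ X) (m T.unop))
      map := fun {T T'} f => GrpCat.ofHom (MonoidHom.mk' (fun h => ⟨f.unop ≫ h.a, f.unop ≫ h.b, f.unop ≫ h.c⟩) (by
        intro p q
        change Heis.mk _ _ _ = Heis.mk _ _ _
        ext <;> simp [HMul.hMul, Mul.mul, hadd, hm]))
      map_id := fun T => by ext h <;> simp
      map_comp := fun f g => by ext h <;> simp }
  let R : (F ⋙ forget _).RepresentableBy (X ⊗ (X ⊗ X)) :=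
    { homEquiv := fun {T} =>
        { toFun := fun f => (⟨f ≫ fst _ _, f ≫ snd _ _ ≫ fst _ _, f ≫ snd _ _ ≫ snd _ _⟩ : Heis (T ⟶ X) (m T))
          invFun := fun (h : Heis (T ⟶ X) (m T)) => lift h.a (lift h.b h.c)
          left_inv := fun f => by ext <;> simp
          right_inv := fun h => by apply Heis.ext <;> simp }
      homEquiv_comp := fun f g => by
        apply Heis.ext <;> simp [F] }
  let G : GrpObj (X ⊗ (X ⊗ X)) := GrpObj.ofRepresentableBy _ F R
  have hG := H G
  have key (a b : T ⟶ X ⊗ (X ⊗ X)) : R.homEquiv' (lift a b ≫ μ) = (R.homEquiv' a * R.homEquiv' b : Heis (T ⟶ X) (m T)) := by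
    change R.homEquiv' (lift a b ≫ R.homEquiv'.symm (R.homEquiv' (fst _ _) *
          R.homEquiv' (snd _ _))) = R.homEquiv' a * R.homEquiv' b
    have e := fun (p q : (F.obj (Opposite.op ((X ⊗ (X ⊗ X)) ⊗ (X ⊗ (X ⊗ X)))))) =>
      map_mul (F.map (lift a b).op).hom p q
    rw [R.homEquiv'_comp, Equiv.apply_symm_apply]
    refine (e _ _).trans ?_
    have e1 := R.homEquiv'_comp (lift a b) (fst _ _)
    have e2 := R.homEquiv'_comp (lift a b) (snd _ _)
    rw [lift_fst] at e1
    rw [lift_snd] at e2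
    exact congrArg₂ _ e1.symm e2.symm
  have hc (a b : T ⟶ X ⊗ (X ⊗ X)) : lift a b ≫ μ = lift b a ≫ μ := by
    exact lift_mul_comm _ a b
  have h1 := congrArg R.homEquiv' (hc (lift x (lift 0 0)) (lift 0 (lift y 0)))
  have e (a b c : T ⟶ X) : R.homEquiv' (lift a (lift b c)) = (⟨a, b, c⟩ : Heis (T ⟶ X) (m T)) :=
    R.homEquiv.apply_symm_apply (⟨a, b, c⟩ : Heis (T ⟶ X) (m T))
  rw [key, key, e, e] at h1
  have h2 : (0 + 0 : T ⟶ X) + m T x y = 0 + 0 + m T 0 0 := congrArg Heis.c h1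
  simpa using h2
end

open TensorProduct in
theorem tensor_domain (K A B : Type*) [Field K] [IsAlgClosed K] [CommRing A] [CommRing B] [Algebra K A] [Algebra K B]
    [IsDomain A] [IsDomain B] [Algebra.FiniteType K A] : IsDomain (A ⊗[K] B) := by
  have : Nontrivial (A ⊗[K] B) := inferInstance
  let b := Module.Basis.ofVectorSpace K B
  let b' := b.baseChange A
  have key (m : Ideal A) (hm : m.IsMaximal) : ∃ φ : A ⊗[K] B →+* B, ∀ x, φ x = 0 ↔ ∀ i, b'.repr x i ∈ m := by
    let := Ideal.Quotient.field m
    have : Module.Finite K (A ⧸ m) := finite_of_finite_type_of_isJacobsonRing K (A ⧸ m)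
    have hbij := IsAlgClosed.algebraMap_bijective_of_isIntegral (k := K) (K := A ⧸ m)
    let e : K ≃ₐ[K] (A ⧸ m) := AlgEquiv.ofBijective (Algebra.ofId K _) hbij
    let q : A →ₐ[K] K := e.symm.toAlgHom.comp (Ideal.Quotient.mkₐ K m)
    have hq (a) : q a = 0 ↔ a ∈ m := by
      simp [q, Ideal.Quotient.eq_zero_iff_mem]
    let φ : A ⊗[K] B →ₐ[K] B := Algebra.TensorProduct.lift ((Algebra.ofId K B).comp q) (AlgHom.id K B) (fun _ _ => Commute.all _ _)
    refine ⟨φ, fun x => ?_⟩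
    have h (x) : ∀ i, b.repr (φ x) i = q (b'.repr x i) := by
      induction x with
      | zero => simp
      | add x y hx hy => intro i; simp [hx, hy]
      | tmul a c =>
        intro i
        simp only [φ, b', Algebra.TensorProduct.lift_tmul, AlgHom.comp_apply, Algebra.ofId_apply, ← Algebra.smul_def, AlgHom.id_apply, map_smul, Module.Basis.baseChange_repr_tmul, Finsupp.smul_apply, smul_eq_mul]
        rw [mul_comm]
    simp only [← hq, ← h]
    change φ x = 0 ↔ _
    rw [← b.repr.map_eq_zero_iff, Finsupp.ext_iff]; simp
  have : NoZeroDivisors (A ⊗[K] B) := by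
    refine ⟨fun {x y} hxy => ?_⟩
    by_contra! h
    obtain ⟨i, hi⟩ : ∃ i, b'.repr x i ≠ 0 := by
      by_contra! h'; exact h.1 (b'.repr.map_eq_zero_iff.mp (Finsupp.ext h'))
    obtain ⟨j, hj⟩ : ∃ i, b'.repr y i ≠ 0 := by
      by_contra! h'; exact h.2 (b'.repr.map_eq_zero_iff.mp (Finsupp.ext h'))
    apply mul_ne_zero hi hj
    have hJ : IsJacobsonRing A := isJacobsonRing_of_finiteType (A := K)
    have : (⊥ : Ideal A).jacobson = ⊥ := hJ.out Ideal.isRadical_bot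
    rw [← Ideal.mem_bot, ← this, Ideal.jacobson, Ideal.mem_sInf]
    rintro m ⟨-, hm⟩
    obtain ⟨φ, hφ⟩ := key m hm
    have : φ x * φ y = 0 := by rw [← map_mul, hxy, map_zero]
    rcases mul_eq_zero.mp this with h | h
    · exact m.mul_mem_right _ ((hφ x).mp h i)
    · exact m.mul_mem_left _ ((hφ y).mp h j)
  exact NoZeroDivisors.to_isDomain _

theorem geomIntegral_affine (K L : Type) [Field K] [IsAlgClosed K] (A : CommRingCat) [IsIntegral (Spec A)] [Field L]
    (f : Spec A ⟶ Spec (CommRingCat.of K)) (g : Spec (.of L) ⟶ Spec (CommRingCat.of K)) [LocallyOfFiniteType f] :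
    IsIntegral (pullback f g) := by
  obtain ⟨f, rfl⟩ := Spec.map_surjective f
  obtain ⟨g, rfl⟩ := Spec.map_surjective g
  let : Algebra K A := f.hom.toAlgebra
  let : Algebra K L := g.hom.toAlgebra
  have : Algebra.FiniteType K A := by
    rw [HasRingHomProperty.Spec_iff (P := @LocallyOfFiniteType)] at *
    exact ‹f.hom.FiniteType›
  have : IsDomain A := (affine_isIntegral_iff _).mp inferInstance
  have := tensor_domain K A L
  exact isIntegral_of_isOpenImmersion (pullbackSpecIso K A L).hom


theorem geomIntegral (K : Type) [Field K] [IsAlgClosed K] (X : Scheme) [IsIntegral X]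
    (s : X ⟶ Spec (CommRingCat.of K)) [LocallyOfFiniteType s] : GeometricallyIntegral s := by
  rw [geometricallyIntegral_iff]
  intro L _ y Z fst snd hZ
  suffices IsIntegral (pullback s y) by
    have : Nonempty Z := ⟨hZ.isoPullback.inv (Nonempty.some inferInstance)⟩
    exact isIntegral_of_isOpenImmersion hZ.isoPullback.hom
  let 𝒱 := X.affineOpenCover
  let 𝒰 := Scheme.Pullback.openCoverOfLeft 𝒱.openCover s y
  have hint (i : 𝒱.I₀) (hi : Nonempty (Spec (𝒱.X i))) :
      IsIntegral (pullback (𝒱.f i ≫ s) y) := by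
    have : IsIntegral (Spec (𝒱.X i)) := isIntegral_of_isOpenImmersion (𝒱.f i)
    exact geomIntegral_affine K L (𝒱.X i) (𝒱.f i ≫ s) y
  have hred (i : 𝒰.I₀) : AlgebraicGeometry.IsReduced (𝒰.X i) := by
    change AlgebraicGeometry.IsReduced (pullback (𝒱.f i ≫ s) y)
    by_cases hi : Nonempty (Spec (𝒱.X i))
    · have := hint i hi
      infer_instance
    · have : IsEmpty ↥(pullback (𝒱.f i ≫ s) y) :=
        ⟨fun p => hi ⟨pullback.fst (𝒱.f i ≫ s) y p⟩⟩
      refine ⟨fun U => ?_⟩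
      have : Subsingleton Γ(pullback (𝒱.f i ≫ s) y, U) := by
        rw [Subsingleton.elim U ⊥]; infer_instance
      exact ⟨fun x _ => Subsingleton.elim _ _⟩
  have := IsReduced.of_openCover _ 𝒰
  have : IrreducibleSpace ↥(pullback s y) := by
    obtain ⟨x⟩ : Nonempty X := inferInstance
    obtain ⟨i, p, hp⟩ := 𝒱.openCover.exists_eq x
    have := hint i ⟨p⟩
    let j : pullback (𝒱.f i ≫ s) y ⟶ pullback s y :=
      pullback.map _ _ _ _ (𝒱.f i) (𝟙 _) (𝟙 _) (by simp) (by simp)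
    have hr : Set.range j = pullback.fst s y ⁻¹' Set.range (𝒱.f i) := by
      simp [j, Scheme.Pullback.range_map]
    have hirr : IsIrreducible (Set.range j) := by
      rw [← Set.image_univ]
      exact (IrreducibleSpace.isIrreducible_univ _).image _ j.continuous.continuousOn
    have : IsOpenImmersion (𝒱.f i) := inferInstanceAs (IsOpenImmersion (𝒱.openCover.f i))
    have hW : IsOpen (Set.range (𝒱.f i)) := (𝒱.f i).isOpenEmbedding.isOpen_range
    have hopen : IsOpenMap (pullback.fst s y) := (pullback.fst s y).isOpenMap
    have hmeet (O : Set ↥(pullback s y)) (hO : IsOpen O) (hne : O.Nonempty) : (Set.range j ∩ O).Nonempty := by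
      obtain ⟨w, hw, ⟨o, ho, rfl⟩⟩ := nonempty_preirreducible_inter hW (hopen _ hO) ⟨_, p, rfl⟩ (hne.image _)
      exact ⟨o, hr ▸ hw, ho⟩
    have hpre : PreirreducibleSpace ↥(pullback s y) := by
      refine ⟨fun U V hU hV hU' hV' => ?_⟩
      rw [Set.univ_inter] at hU' hV' ⊢
      obtain ⟨q, -, hq⟩ := hirr.2 U V hU hV (hmeet U hU hU') (hmeet V hV hV')
      exact ⟨q, hq⟩
    exact { toPreirreducibleSpace := hpre, toNonempty := ⟨j (Nonempty.some inferInstance)⟩ }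
  exact isIntegral_of_irreducibleSpace_of_isReduced _

section
open MonoidalCategory CartesianMonoidalCategory MonObj

theorem cube_comm (K : Type) [Field K] [IsAlgClosed K]
    (X : Scheme) [IsIntegral X]
    (s : X ⟶ Spec (CommRingCat.of K)) [IsProper s]
    (_ : GrpObj (Over.mk s ⊗ (Over.mk s ⊗ Over.mk s))) :
    IsCommMonObj (Over.mk s ⊗ (Over.mk s ⊗ Over.mk s)) := by
  have := geomIntegral K X s
  have := LocallyOfFiniteType.isLocallyNoetherian s
  have i1 : IsIntegral (pullback s s) := inferInstance
  have l1 : LocallyOfFiniteType (pullback.fst s s ≫ s) := inferInstance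
  have := LocallyOfFiniteType.isLocallyNoetherian (pullback.fst s s ≫ s)
  have i2 : IsIntegral (pullback s (pullback.fst s s ≫ s)) := inferInstance
  have : IsProper (Over.mk s ⊗ (Over.mk s ⊗ Over.mk s)).hom := by
    dsimp; infer_instance
  have : IsIntegral (Over.mk s ⊗ (Over.mk s ⊗ Over.mk s)).left := i2
  have := geomIntegral K _ (Over.mk s ⊗ (Over.mk s ⊗ Over.mk s)).hom
  exact isCommMonObj_of_isProper_of_geometricallyIntegral _
end

theorem ptOp_comp {X S : Scheme} (s : X ⟶ S) (μ : pullback s s ⟶ X)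
    {T T' : Scheme} (f : T' ⟶ T) (x y : T ⟶ X) (h : x ≫ s = y ≫ s)
    (h' : (f ≫ x) ≫ s = (f ≫ y) ≫ s) :
    f ≫ ptOp s μ x y h = ptOp s μ (f ≫ x) (f ≫ y) h' := by
  unfold ptOp
  rw [← Category.assoc]
  congr 1
  apply pullback.hom_ext
  · rw [Category.assoc, pullback.lift_fst, pullback.lift_fst]
  · rw [Category.assoc, pullback.lift_snd, pullback.lift_snd]

theorem ptOp_over {X S : Scheme} (s : X ⟶ S) (μ : pullback s s ⟶ X)
    (hμ : μ ≫ s = pullback.fst s s ≫ s) {T : Scheme} (x y : T ⟶ X) (h : x ≫ s = y ≫ s) :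
    ptOp s μ x y h ≫ s = x ≫ s := by
  rw [ptOp, Category.assoc, hμ, ← Category.assoc, pullback.lift_fst]

/-- Let `X` be a complete (proper over `K`) irreducible variety over an
algebraically closed field `K`, equipped with morphisms `α, μ : X ×_K X ⟶ X`
satisfying the algebraic-ring axioms (I)–(III) — `(X, α)` is a commutative algebraic
group over `K` with zero section `z` and inversion `ι`, `μ` is associative, and `μ`
distributes over `α` on both sides (all expressed on `T`-valued points for arbitrary
schemes `T`) — but not necessarily possessing a multiplicative identity.  Then the
multiplication is identically zero: `μ` factors as the composite
`X ×_K X ⟶ Spec K ⟶ X` of the structure map with the zero section. -/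
theorem stmt_16 (K : Type) [Field K] [IsAlgClosed K]
    (X : Scheme) [IsIntegral X]
    (s : X ⟶ Spec (CommRingCat.of K))
    [UniversallyClosed s] [AlgebraicGeometry.IsSeparated s]
    [LocallyOfFiniteType s] [QuasiCompact s]
    (α μ : pullback s s ⟶ X)
    (z : Spec (CommRingCat.of K) ⟶ X) (ι : X ⟶ X)
    (hα : α ≫ s = pullback.fst s s ≫ s)
    (hμ : μ ≫ s = pullback.fst s s ≫ s)
    (hz : z ≫ s = 𝟙 _) (hι : ι ≫ s = s)
    -- (I) `(X, α)` is a commutative algebraic group over `K`: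
    (hcomm : ∀ (T : Scheme) (x y : T ⟶ X) (h : x ≫ s = y ≫ s),
      ptOp s α x y h = ptOp s α y x h.symm)
    (haddassoc : ∀ (T : Scheme) (x y w : T ⟶ X)
      (hxy : x ≫ s = y ≫ s) (hyw : y ≫ s = w ≫ s)
      (h1 : ptOp s α x y hxy ≫ s = w ≫ s)
      (h2 : x ≫ s = ptOp s α y w hyw ≫ s),
      ptOp s α (ptOp s α x y hxy) w h1 = ptOp s α x (ptOp s α y w hyw) h2)
    (hzero : ∀ (T : Scheme) (x : T ⟶ X) (h : (x ≫ s ≫ z) ≫ s = x ≫ s),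
      ptOp s α (x ≫ s ≫ z) x h = x)
    (hneg : ∀ (T : Scheme) (x : T ⟶ X) (h : (x ≫ ι) ≫ s = x ≫ s),
      ptOp s α (x ≫ ι) x h = x ≫ s ≫ z)
    -- (II) associativity of `μ`:
    (hmulassoc : ∀ (T : Scheme) (x y w : T ⟶ X)
      (hxy : x ≫ s = y ≫ s) (hyw : y ≫ s = w ≫ s)
      (h1 : ptOp s μ x y hxy ≫ s = w ≫ s)
      (h2 : x ≫ s = ptOp s μ y w hyw ≫ s),
      ptOp s μ (ptOp s μ x y hxy) w h1 = ptOp s μ x (ptOp s μ y w hyw) h2)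
    -- (III) distributivity of `μ` over `α` on both sides:
    (hldistrib : ∀ (T : Scheme) (x y w : T ⟶ X)
      (hyw : y ≫ s = w ≫ s) (hxy : x ≫ s = y ≫ s) (hxw : x ≫ s = w ≫ s)
      (h1 : x ≫ s = ptOp s α y w hyw ≫ s)
      (h2 : ptOp s μ x y hxy ≫ s = ptOp s μ x w hxw ≫ s),
      ptOp s μ x (ptOp s α y w hyw) h1 =
        ptOp s α (ptOp s μ x y hxy) (ptOp s μ x w hxw) h2)
    (hrdistrib : ∀ (T : Scheme) (x y w : T ⟶ X)
      (hxy : x ≫ s = y ≫ s) (hxw : x ≫ s = w ≫ s) (hyw : y ≫ s = w ≫ s)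
      (h1 : ptOp s α x y hxy ≫ s = w ≫ s)
      (h2 : ptOp s μ x w hxw ≫ s = ptOp s μ y w hyw ≫ s),
      ptOp s μ (ptOp s α x y hxy) w h1 =
        ptOp s α (ptOp s μ x w hxw) (ptOp s μ y w hyw) h2) :
    μ = pullback.fst s s ≫ s ≫ z := by
  have hpr : IsProper s := {}
  have hw {T : Over (Spec (CommRingCat.of K))} (a b : T ⟶ Over.mk s) : a.left ≫ s = b.left ≫ s :=
    (Over.w a).trans (Over.w b).symm
  let add {T : Over (Spec (CommRingCat.of K))} (a b : T ⟶ Over.mk s) : T ⟶ Over.mk s :=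
    Over.homMk (ptOp s α a.left b.left (hw a b)) ((ptOp_over s α hα _ _ _).trans (Over.w a))
  let mul {T : Over (Spec (CommRingCat.of K))} (a b : T ⟶ Over.mk s) : T ⟶ Over.mk s :=
    Over.homMk (ptOp s μ a.left b.left (hw a b)) ((ptOp_over s μ hμ _ _ _).trans (Over.w a))
  let zero (T : Over (Spec (CommRingCat.of K))) : T ⟶ Over.mk s :=
    Over.homMk (T.hom ≫ z) (by simp [hz])
  let neg {T : Over (Spec (CommRingCat.of K))} (a : T ⟶ Over.mk s) : T ⟶ Over.mk s :=
    Over.homMk (a.left ≫ ι) (by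
      change (a.left ≫ ι) ≫ s = _
      rw [Category.assoc, hι]; exact Over.w a)
  have hze {T : Over (Spec (CommRingCat.of K))} (a : T ⟶ Over.mk s) :
      (zero T).left = a.left ≫ s ≫ z := by
    change T.hom ≫ z = _
    rw [← Over.w a]; simp
  have addc {T : Over (Spec (CommRingCat.of K))} (a b : T ⟶ Over.mk s) : add a b = add b a :=
    Over.OverMorphism.ext (hcomm _ _ _ _)
  have zadd {T : Over (Spec (CommRingCat.of K))} (a : T ⟶ Over.mk s) : add (zero T) a = a := by
    apply Over.OverMorphism.ext
    have e := hze a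
    have h1 := hw (zero T) a
    change ptOp s α (zero T).left a.left h1 = a.left
    revert h1
    rw [e]
    exact hzero _ _
  have nadd {T : Over (Spec (CommRingCat.of K))} (a : T ⟶ Over.mk s) : add (neg a) a = zero T := by
    apply Over.OverMorphism.ext
    rw [hze a]
    exact hneg _ _ _
  let inst (T : Over (Spec (CommRingCat.of K))) : AddCommGroup (T ⟶ Over.mk s) :=
    letI : Add (T ⟶ Over.mk s) := ⟨add⟩
    letI : Zero (T ⟶ Over.mk s) := ⟨zero T⟩
    letI : Neg (T ⟶ Over.mk s) := ⟨neg⟩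
    {
      add_assoc := fun a b c => Over.OverMorphism.ext (haddassoc _ _ _ _ _ _ _ _)
      zero_add := zadd
      add_zero := fun a => (addc a (zero T)).trans (zadd a)
      neg_add_cancel := nadd
      add_comm := addc
      nsmul := nsmulRec
      zsmul := zsmulRec }
  have h := heis_zero (C := Over (Spec (CommRingCat.of K))) (Over.mk s)
    (fun f a b => Over.OverMorphism.ext (ptOp_comp _ _ _ _ _ _ _))
    (fun T => AddMonoidHom.mk' (fun a => AddMonoidHom.mk' (fun b => mul a b)
        (fun b c => Over.OverMorphism.ext (hldistrib _ _ _ _ _ _ _ _ _)))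
      (fun a b => AddMonoidHom.ext fun c => Over.OverMorphism.ext (hrdistrib _ _ _ _ _ _ _ _ _)))
    (fun f a b => Over.OverMorphism.ext (ptOp_comp _ _ _ _ _ _ _))
    (cube_comm K X s) (Over.mk (pullback.fst s s ≫ s))
    (Over.homMk (pullback.fst s s) rfl) (Over.homMk (pullback.snd s s) pullback.condition.symm)
  have h2 : ptOp s μ (pullback.fst s s) (pullback.snd s s) pullback.condition
      = (pullback.fst s s ≫ s) ≫ z := congrArg (fun f => f.left) h
  rw [Category.assoc] at h2
  rw [← h2, ptOp]
  simp
end
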